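/- If t is a positive integer with t ≡ 3 or 5 (mod 6), then there does not exist a cyclic skew frame starter of type 3^t in Z_{3t}. -/

import Mathlib

/-- The family `f`, indexed by `Fin m ⊕ Fin m`, hits each element of `G \\ H`
exactly once. -/
def CoversComplement {G : Type*} [AddCommGroup G] (H : AddSubgroup G) {m : ℕ}
    (f : Fin m ⊕ Fin m → G) : Prop :=
  Function.Injective f ∧ Set.range f = {z : G | z ∉ H}

/-- The pairs `{x i, y i}` form a frame starter in `G \\ H`: the entries hit each
element of `G \\ H` exactly once, and so do the differences `±(x i - y i)`. -/
def IsFrameStarter {G : Type*} [AddCommGroup G] (H : AddSubgroup G) {m : ℕ}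
    (x y : Fin m → G) : Prop :=
  CoversComplement H (Sum.elim x y) ∧
    CoversComplement H (Sum.elim (fun i => x i - y i) (fun i => y i - x i))

/-- A frame starter is strong if the sums `x i + y i` avoid `H` and are pairwise
distinct. -/
def IsStrongFS {G : Type*} [AddCommGroup G] (H : AddSubgroup G) {m : ℕ}
    (x y : Fin m → G) : Prop :=
  (∀ i, x i + y i ∉ H) ∧ Function.Injective fun i => x i + y i

/-- A frame starter is skew if the sums `±(x i + y i)` hit each element of
`G \\ H` exactly once. -/
def IsSkewFS {G : Type*} [AddCommGroup G] (H : AddSubgroup G) {m : ℕ}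
    (x y : Fin m → G) : Prop :=
  CoversComplement H (Sum.elim (fun i => x i + y i) (fun i => -(x i + y i)))

/-- Summing over a family that covers `G \\ H` is summing over `G \\ H`. -/
lemma CoversComplement.sum_eq {G M : Type*} [AddCommGroup G] [Fintype G] [AddCommMonoid M]
    {H : AddSubgroup G} [DecidablePred (· ∈ H)] {m : ℕ} {f : Fin m ⊕ Fin m → G}
    (hf : CoversComplement H f) (φ : G → M) :
    ∑ i, φ (f i) = ∑ z with z ∉ H, φ z := by
  refine Finset.sum_bij (fun i _ => f i) (fun i _ => ?_) (fun i _ j _ h => hf.1 h)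
    (fun z hz => ?_) (fun _ _ => rfl)
  · have h : f i ∈ {z : G | z ∉ H} := hf.2 ▸ Set.mem_range_self i
    simpa using h
  · have h : z ∈ Set.range f := by
      rw [hf.2]
      simpa using hz
    obtain ⟨i, hi⟩ := h
    exact ⟨i, Finset.mem_univ i, hi⟩

/-- A skew frame starter in the additive group of a commutative ring forces twice the sum of the
squares of the elements outside `H` to vanish. -/
lemma two_mul_sum_sq_eq_zero_of_isSkewFS {R : Type*} [CommRing R] [Fintype R]
    {H : AddSubgroup R} [DecidablePred (· ∈ H)] {m : ℕ} {x y : Fin m → R}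
    (hF : IsFrameStarter H x y) (hS : IsSkewFS H x y) :
    2 * ∑ z with z ∉ H, z ^ 2 = 0 := by
  have entries := hF.1.sum_eq (· ^ 2)
  have diffs := hF.2.sum_eq (· ^ 2)
  have sums := CoversComplement.sum_eq hS (· ^ 2)
  simp only [Fintype.sum_sum_type, Sum.elim_inl, Sum.elim_inr, ← Finset.sum_add_distrib]
    at entries diffs sums
  have parallelogram : ∑ i, ((x i - y i) ^ 2 + (y i - x i) ^ 2) +
      ∑ i, ((x i + y i) ^ 2 + (-(x i + y i)) ^ 2) = 4 * ∑ i, (x i ^ 2 + y i ^ 2) := by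
    rw [← Finset.sum_add_distrib, Finset.mul_sum]
    exact Finset.sum_congr rfl fun i _ => by ring
  rw [entries, diffs, sums] at parallelogram
  linear_combination -parallelogram

lemma ZMod.sum_univ_eq_sum_range {M : Type*} [AddCommMonoid M] (n : ℕ) [NeZero n]
    (φ : ZMod n → M) : ∑ z, φ z = ∑ k ∈ Finset.range n, φ k :=
  Finset.sum_nbij' ZMod.val Nat.cast (fun z _ => Finset.mem_range.2 z.val_lt)
    (fun _ _ => Finset.mem_univ _) (fun z _ => ZMod.natCast_zmod_val z)
    (fun _ hk => ZMod.val_cast_of_lt (Finset.mem_range.1 hk))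
    (fun z _ => by rw [ZMod.natCast_zmod_val])

lemma six_mul_sum_range_sq {R : Type*} [CommRing R] (n : ℕ) :
    6 * ∑ k ∈ Finset.range n, (k : R) ^ 2 = (n - 1) * n * (2 * n - 1) := by
  induction n with
  | zero => simp
  | succ n ih =>
    rw [Finset.sum_range_succ, mul_add, ih]
    push_cast
    ring

lemma ZMod.two_mul_sum_sq (t : ℕ) [NeZero (3 * t)] :
    2 * ∑ z : ZMod (3 * t), z ^ 2 = t := by
  have formula : 2 * ∑ k ∈ Finset.range (3 * t), (k : ℤ) ^ 2 =
      (3 * t - 1) * t * (6 * t - 1) := by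
    have h := six_mul_sum_range_sq (R := ℤ) (3 * t)
    push_cast at h
    linarith
  have h3t : (3 : ZMod (3 * t)) * t = 0 := by
    exact_mod_cast ZMod.natCast_self (3 * t)
  have cast_formula := congrArg (Int.cast : ℤ → ZMod (3 * t)) formula
  push_cast at cast_formula
  rw [ZMod.sum_univ_eq_sum_range, cast_formula]
  linear_combination (6 * (t : ZMod (3 * t)) - 3) * t * h3t

lemma ZMod.sum_sq_zmultiples (t : ℕ) [NeZero (3 * t)]
    [DecidablePred (· ∈ AddSubgroup.zmultiples (t : ZMod (3 * t)))] :
    ∑ z with z ∈ AddSubgroup.zmultiples (t : ZMod (3 * t)), z ^ 2 = 5 * (t : ZMod (3 * t)) ^ 2 := by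
  have ht : 0 < t := Nat.pos_of_ne_zero fun h => NeZero.ne (3 * t) (by simp [h])
  have order : addOrderOf (t : ZMod (3 * t)) = 3 := by
    rw [ZMod.addOrderOf_coe _ (NeZero.ne _), Nat.gcd_eq_right (Dvd.intro_left 3 rfl),
      Nat.mul_div_cancel _ ht]
  have image : ({z | z ∈ AddSubgroup.zmultiples (t : ZMod (3 * t))} : Finset (ZMod (3 * t))) =
      (Finset.range 3).image (· • (t : ZMod (3 * t))) := by
    ext z
    have h := mem_zmultiples_iff_mem_range_addOrderOf (x := (t : ZMod (3 * t))) (y := z)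
    rwa [order, ← Finset.mem_filter_univ (p := (· ∈ AddSubgroup.zmultiples _))] at h
  rw [image, Finset.sum_image]
  · simp only [Finset.sum_range_succ, Finset.sum_range_zero, nsmul_eq_mul]
    push_cast
    ring
  · have h := nsmul_injOn_Iio_addOrderOf (x := (t : ZMod (3 * t)))
    rwa [order, ← Finset.coe_Iio, Nat.Iio_eq_range] at h

/-- If `t ≡ 3` or `5 (mod 6)`, then there is no cyclic skew frame
starter of type `3^t` in `ℤ_{3t}` (with `H = {0, t, 2t}`). -/
theorem stmt10 (t : ℕ) (ht : 0 < t) (hmod : t % 6 = 3 ∨ t % 6 = 5) :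
    ¬ ∃ (m : ℕ) (x y : Fin m → ZMod (3 * t)),
      IsFrameStarter (AddSubgroup.zmultiples (t : ZMod (3 * t))) x y ∧
        IsSkewFS (AddSubgroup.zmultiples (t : ZMod (3 * t))) x y := by
  rintro ⟨m, x, y, hF, hS⟩
  have : NeZero (3 * t) := ⟨by omega⟩
  classical
  have vanish := two_mul_sum_sq_eq_zero_of_isSkewFS hF hS
  have split := Finset.sum_filter_add_sum_filter_not Finset.univ
    (· ∈ AddSubgroup.zmultiples (t : ZMod (3 * t))) (· ^ 2)
  rw [ZMod.sum_sq_zmultiples] at split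
  have h3t : (3 : ZMod (3 * t)) * t = 0 := by
    exact_mod_cast ZMod.natCast_self (3 * t)
  have key : ((t * (t - 1) : ℤ) : ZMod (3 * t)) = 0 := by
    push_cast
    linear_combination 2 * split - vanish + ZMod.two_mul_sum_sq t - 3 * (t : ZMod (3 * t)) * h3t
  rw [ZMod.intCast_zmod_eq_zero_iff_dvd] at key
  push_cast at key
  rw [mul_comm (3 : ℤ), mul_dvd_mul_iff_left (by omega)] at key
  omega
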